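/- arXiv:2204.00938 — 2 statements merged into one kernel-verified Lean document; each statement's English description precedes it below -/
import Mathlib

section
/- Let ⟨ξ,π⟩ : E ⥤ A × B be a two-sided fibration, let a₀ be an initial object of A and let b₀ be a terminal object of B. Then the evaluation functor TwoSect(E) ⥤ E_(a₀,b₀), sending a two-sided cartesian section σ to σ(a₀,b₀) and a vertical natural transformation μ to its component μ_(a₀,b₀), is an equivalence of categories. (Two-sided fibrations over a base with an initial and a terminal object: sections are determined by their value at the initial–terminal pair.) -/
open CategoryTheory

universe w v₁ u₁ v₂ u₂ v₃ u₃ v₄ u₄ v₅ u₅ v₆ u₆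

section BasicDefs

variable {E : Type u₁} [Category.{v₁} E] {B : Type u₂} [Category.{v₂} B]
  {A : Type u₃} [Category.{v₃} A]

/-- `f` is a `π`-opcartesian morphism. -/
def IsOpcartesianMor (π : E ⥤ B) {e e' : E} (f : e ⟶ e') : Prop :=
  ∀ ⦃e'' : E⦄ (g : e ⟶ e'') (w : π.obj e' ⟶ π.obj e''),
    π.map f ≫ w = π.map g → ∃! h : e' ⟶ e'', π.map h = w ∧ f ≫ h = g

/-- `f` is a `π`-cartesian morphism. -/
def IsCartesianMor (π : E ⥤ B) {e' e : E} (f : e' ⟶ e) : Prop :=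
  ∀ ⦃e'' : E⦄ (g : e'' ⟶ e) (w : π.obj e'' ⟶ π.obj e'),
    w ≫ π.map f = π.map g → ∃! h : e'' ⟶ e', π.map h = w ∧ h ≫ f = g

/-- `f` is `π`-vertical, i.e. `π` sends it to an identity. -/
def IsVerticalMor (π : E ⥤ B) {e e' : E} (f : e ⟶ e') : Prop :=
  ∃ h : π.obj e = π.obj e', π.map f = eqToHom h

/-- `π` is a Grothendieck opfibration. -/
def IsGrothendieckOpfib (π : E ⥤ B) : Prop :=
  ∀ (e : E) ⦃b : B⦄ (u : π.obj e ⟶ b),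
    ∃ (e' : E) (f : e ⟶ e') (hb : π.obj e' = b),
      IsOpcartesianMor π f ∧ π.map f ≫ eqToHom hb = u

/-- `π` is a Grothendieck fibration. -/
def IsGrothendieckFib (π : E ⥤ B) : Prop :=
  ∀ (e : E) ⦃b : B⦄ (v : b ⟶ π.obj e),
    ∃ (e' : E) (f : e' ⟶ e) (hb : π.obj e' = b),
      IsCartesianMor π f ∧ eqToHom hb.symm ≫ π.map f = v

/-- `φ` is a cocartesian fibration sliced over the base of `π`. -/
def IsSlicedCocartFib {F : Type u₄} [Category.{v₄} F] (π : E ⥤ B) (φ : F ⥤ E) : Prop :=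
  ∀ (x : F) (e : E) (k : φ.obj x ⟶ e), IsVerticalMor π k →
    ∃ (x' : F) (f : x ⟶ x') (he : φ.obj x' = e),
      IsOpcartesianMor φ f ∧ φ.map f ≫ eqToHom he = k

/-- The span `⟨ξ,π⟩` is cocartesian on the left. -/
def CocartOnLeft (ξ : E ⥤ A) (π : E ⥤ B) : Prop :=
  ∀ (e : E) ⦃a' : A⦄ (u : ξ.obj e ⟶ a'),
    ∃ (e' : E) (f : e ⟶ e') (ha : ξ.obj e' = a'),
      IsOpcartesianMor ξ f ∧ IsVerticalMor π f ∧ ξ.map f ≫ eqToHom ha = u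

/-- The span `⟨ξ,π⟩` is cartesian on the right. -/
def CartOnRight (ξ : E ⥤ A) (π : E ⥤ B) : Prop :=
  ∀ (e : E) ⦃b' : B⦄ (v : b' ⟶ π.obj e),
    ∃ (e' : E) (f : e' ⟶ e) (hb : π.obj e' = b'),
      IsCartesianMor π f ∧ IsVerticalMor ξ f ∧ eqToHom hb.symm ≫ π.map f = v

/-- `f` and `g` lie over the same arrow of the base (up to `eqToHom`). -/
def OverSameArrow (ξ : E ⥤ A) {x y x' y' : E} (f : x ⟶ y) (g : x' ⟶ y') : Prop :=
  ∃ (p : ξ.obj x = ξ.obj x') (q : ξ.obj y = ξ.obj y'),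
    ξ.map f ≫ eqToHom q = eqToHom p ≫ ξ.map g

/-- Cocartesian and cartesian lifts commute: every comparison morphism
`h : u_!(v^* e) ⟶ v^*(u_! e)` is an isomorphism. -/
def LiftsCommute (ξ : E ⥤ A) (π : E ⥤ B) : Prop :=
  ∀ ⦃e e₁ e₂ e₃ e₄ : E⦄ (k : e ⟶ e₁) (k' : e₂ ⟶ e) (f : e₂ ⟶ e₃) (f' : e₄ ⟶ e₁)
    (g : e₃ ⟶ e₁) (h : e₃ ⟶ e₄),
    IsOpcartesianMor ξ k → IsVerticalMor π k →
    IsCartesianMor π k' → IsVerticalMor ξ k' →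
    IsOpcartesianMor ξ f → IsVerticalMor π f → OverSameArrow ξ f k →
    IsCartesianMor π f' → IsVerticalMor ξ f' → OverSameArrow π f' k' →
    IsVerticalMor ξ g → f ≫ g = k' ≫ k →
    IsVerticalMor ξ h → IsVerticalMor π h → h ≫ f' = g →
    IsIso h

/-- Two-sided (cartesian) fibration. -/
def IsTwoSidedFib (ξ : E ⥤ A) (π : E ⥤ B) : Prop :=
  CocartOnLeft ξ π ∧ CartOnRight ξ π ∧ LiftsCommute ξ π

end BasicDefs

section DiscreteDefs

variable {E : Type u₁} [Category.{v₁} E] {A : Type u₂} [Category.{v₂} A]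
  {B : Type u₃} [Category.{v₃} B]

/-- The fiber `E_b` of the span over `b : B`: objects of `E` over `b` and
`π`-vertical morphisms. -/
structure FiberOverB (π : E ⥤ B) (b : B) where
  e : E
  h : π.obj e = b

/-- Morphisms of the fiber `E_b`: `π`-vertical morphisms. -/
structure FiberOverBHom {π : E ⥤ B} {b : B} (X Y : FiberOverB π b) where
  f : X.e ⟶ Y.e
  w : π.map f = eqToHom (X.h.trans Y.h.symm)

theorem FiberOverBHom.ext' {π : E ⥤ B} {b : B} {X Y : FiberOverB π b}
    {f g : FiberOverBHom X Y} (h : f.f = g.f) : f = g := by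
  cases f; cases g; cases h; rfl

instance {π : E ⥤ B} {b : B} : Category (FiberOverB π b) where
  Hom := FiberOverBHom
  id X := ⟨𝟙 X.e, by rw [π.map_id]; exact (eqToHom_refl _ _).symm⟩
  comp f g := ⟨f.f ≫ g.f, by rw [π.map_comp, f.w, g.w, eqToHom_trans]⟩
  id_comp f := FiberOverBHom.ext' (by simp)
  comp_id f := FiberOverBHom.ext' (by simp)
  assoc f g h := FiberOverBHom.ext' (by simp)

/-- The functor `E_b ⥤ A` induced by `ξ`. -/
def fiberOverBToLeft (ξ : E ⥤ A) (π : E ⥤ B) (b : B) : FiberOverB π b ⥤ A where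
  obj X := ξ.obj X.e
  map f := ξ.map f.f
  map_id X := ξ.map_id X.e
  map_comp f g := ξ.map_comp f.f g.f

/-- The cofiber `E^a` of the span over `a : A`: objects of `E` over `a` and
`ξ`-vertical morphisms. -/
structure FiberOverA (ξ : E ⥤ A) (a : A) where
  e : E
  h : ξ.obj e = a

/-- Morphisms of the cofiber `E^a`: `ξ`-vertical morphisms. -/
structure FiberOverAHom {ξ : E ⥤ A} {a : A} (X Y : FiberOverA ξ a) where
  f : X.e ⟶ Y.e
  w : ξ.map f = eqToHom (X.h.trans Y.h.symm)

theorem FiberOverAHom.ext' {ξ : E ⥤ A} {a : A} {X Y : FiberOverA ξ a}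
    {f g : FiberOverAHom X Y} (h : f.f = g.f) : f = g := by
  cases f; cases g; cases h; rfl

instance {ξ : E ⥤ A} {a : A} : Category (FiberOverA ξ a) where
  Hom := FiberOverAHom
  id X := ⟨𝟙 X.e, by rw [ξ.map_id]; exact (eqToHom_refl _ _).symm⟩
  comp f g := ⟨f.f ≫ g.f, by rw [ξ.map_comp, f.w, g.w, eqToHom_trans]⟩
  id_comp f := FiberOverAHom.ext' (by simp)
  comp_id f := FiberOverAHom.ext' (by simp)
  assoc f g h := FiberOverAHom.ext' (by simp)

/-- The functor `E^a ⥤ B` induced by `π`. -/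
def fiberOverAToRight (ξ : E ⥤ A) (π : E ⥤ B) (a : A) : FiberOverA ξ a ⥤ B where
  obj X := π.obj X.e
  map f := π.map f.f
  map_id X := π.map_id X.e
  map_comp f g := π.map_comp f.f g.f

/-- A functor is a discrete opfibration if every morphism of the base with a lift of
its domain has a unique lift with that domain. -/
def IsDiscreteOpfib {X : Type u₄} [Category.{v₄} X] (P : X ⥤ A) : Prop :=
  ∀ (x : X) ⦃a' : A⦄ (u : P.obj x ⟶ a'),
    ∃! fy : Σ y : X, x ⟶ y, ∃ h : P.obj fy.1 = a', P.map fy.2 ≫ eqToHom h = u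

/-- A functor is a discrete fibration if every morphism of the base with a lift of
its codomain has a unique lift with that codomain. -/
def IsDiscreteFib {X : Type u₄} [Category.{v₄} X] (P : X ⥤ A) : Prop :=
  ∀ (x : X) ⦃a' : A⦄ (u : a' ⟶ P.obj x),
    ∃! fy : Σ y : X, y ⟶ x, ∃ h : P.obj fy.1 = a', eqToHom h.symm ≫ P.map fy.2 = u

/-- The span `⟨ξ,π⟩` is a two-sided discrete fibration. -/
def TwoSidedDiscreteFib (ξ : E ⥤ A) (π : E ⥤ B) : Prop :=
  (∀ b : B, IsDiscreteOpfib (fiberOverBToLeft ξ π b)) ∧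
  (∀ a : A, IsDiscreteFib (fiberOverAToRight ξ π a))

/-- The bifiber `E_(a,b)` of a span. -/
structure BiFiberCat (ξ : E ⥤ A) (π : E ⥤ B) (a : A) (b : B) where
  e : E
  ha : ξ.obj e = a
  hb : π.obj e = b

/-- Morphisms of the bifiber: sent to identities by both legs. -/
structure BiFiberHom {ξ : E ⥤ A} {π : E ⥤ B} {a : A} {b : B}
    (X Y : BiFiberCat ξ π a b) where
  f : X.e ⟶ Y.e
  wa : ξ.map f = eqToHom (X.ha.trans Y.ha.symm)
  wb : π.map f = eqToHom (X.hb.trans Y.hb.symm)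

theorem BiFiberHom.ext' {ξ : E ⥤ A} {π : E ⥤ B} {a : A} {b : B}
    {X Y : BiFiberCat ξ π a b} {f g : BiFiberHom X Y} (h : f.f = g.f) : f = g := by
  cases f; cases g; cases h; rfl

instance {ξ : E ⥤ A} {π : E ⥤ B} {a : A} {b : B} : Category (BiFiberCat ξ π a b) where
  Hom := BiFiberHom
  id X := ⟨𝟙 X.e, by rw [ξ.map_id]; exact (eqToHom_refl _ _).symm,
    by rw [π.map_id]; exact (eqToHom_refl _ _).symm⟩
  comp f g := ⟨f.f ≫ g.f, by rw [ξ.map_comp, f.wa, g.wa, eqToHom_trans],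
    by rw [π.map_comp, f.wb, g.wb, eqToHom_trans]⟩
  id_comp f := BiFiberHom.ext' (by simp)
  comp_id f := BiFiberHom.ext' (by simp)
  assoc f g h := BiFiberHom.ext' (by simp)

end DiscreteDefs

section TwoSectDefs

variable {E : Type u₁} [Category.{v₁} E] {A : Type u₂} [Category.{v₂} A]
  {B : Type u₃} [Category.{v₃} B]

theorem IsVerticalMor.id' (π : E ⥤ B) (x : E) : IsVerticalMor π (𝟙 x) :=
  ⟨rfl, by rw [π.map_id]; exact (eqToHom_refl _ _).symm⟩

theorem IsVerticalMor.comp' {π : E ⥤ B} {x y z : E} {f : x ⟶ y} {g : y ⟶ z}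
    (hf : IsVerticalMor π f) (hg : IsVerticalMor π g) : IsVerticalMor π (f ≫ g) := by
  obtain ⟨h1, e1⟩ := hf; obtain ⟨h2, e2⟩ := hg
  exact ⟨h1.trans h2, by rw [π.map_comp, e1, e2, eqToHom_trans]⟩

/-- A two-sided cartesian section of the span `⟨ξ,π⟩ : E ⥤ A × B`: a strict section
of `⟨ξ,π⟩` sending `(u, id_b)` to `ξ`-opcartesian morphisms and `(id_a, v)` to
`π`-cartesian morphisms. -/
structure TwoSect (ξ : E ⥤ A) (π : E ⥤ B) where
  σ : A × B ⥤ E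
  sect : σ ⋙ ξ.prod' π = 𝟭 (A × B)
  opcart : ∀ ⦃a a' : A⦄ (u : a ⟶ a') (b : B),
    IsOpcartesianMor ξ (σ.map ((u, 𝟙 b) : (a, b) ⟶ (a', b)))
  cart : ∀ (a : A) ⦃b b' : B⦄ (v : b ⟶ b'),
    IsCartesianMor π (σ.map ((𝟙 a, v) : (a, b) ⟶ (a, b')))

/-- Morphisms of two-sided cartesian sections: natural transformations all of whose
components are both `ξ`-vertical and `π`-vertical. -/
structure TwoSectHom {ξ : E ⥤ A} {π : E ⥤ B} (X Y : TwoSect ξ π) where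
  μ : X.σ ⟶ Y.σ
  vertL : ∀ p : A × B, IsVerticalMor ξ (μ.app p)
  vertR : ∀ p : A × B, IsVerticalMor π (μ.app p)

theorem TwoSectHom.ext' {ξ : E ⥤ A} {π : E ⥤ B} {X Y : TwoSect ξ π}
    {f g : TwoSectHom X Y} (h : f.μ = g.μ) : f = g := by
  cases f; cases g; cases h; rfl

instance {ξ : E ⥤ A} {π : E ⥤ B} : Category (TwoSect ξ π) where
  Hom := TwoSectHom
  id X := ⟨𝟙 X.σ, fun p => IsVerticalMor.id' ξ _, fun p => IsVerticalMor.id' π _⟩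
  comp f g := ⟨f.μ ≫ g.μ, fun p => (f.vertL p).comp' (g.vertL p),
    fun p => (f.vertR p).comp' (g.vertR p)⟩
  id_comp f := TwoSectHom.ext' (Category.id_comp f.μ)
  comp_id f := TwoSectHom.ext' (Category.comp_id f.μ)
  assoc f g h := TwoSectHom.ext' (Category.assoc f.μ g.μ h.μ)

/-- The evaluation functor `TwoSect(E) ⥤ E_(a₀,b₀)`, sending a two-sided cartesian
section `σ` to `σ(a₀,b₀)` and a vertical natural transformation to its component at
`(a₀,b₀)`. -/
def twoSectEval (ξ : E ⥤ A) (π : E ⥤ B) (a₀ : A) (b₀ : B) :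
    TwoSect ξ π ⥤ BiFiberCat ξ π a₀ b₀ where
  obj X := ⟨X.σ.obj (a₀, b₀),
    congrArg Prod.fst (Functor.congr_obj X.sect (a₀, b₀)),
    congrArg Prod.snd (Functor.congr_obj X.sect (a₀, b₀))⟩
  map f := ⟨f.μ.app (a₀, b₀), (f.vertL (a₀, b₀)).choose_spec,
    (f.vertR (a₀, b₀)).choose_spec⟩
  map_id X := BiFiberHom.ext' rfl
  map_comp f g := BiFiberHom.ext' rfl

end TwoSectDefs

section HomLifts

variable {E : Type u₁} [Category.{v₁} E] {B : Type u₂} [Category.{v₂} B]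

theorem isStronglyCartesian_of_isCartesianMor {π : E ⥤ B} {e' e : E} {f : e' ⟶ e}
    (hf : IsCartesianMor π f) {b' b : B} (v : b' ⟶ b) [hv : π.IsHomLift v f] :
    π.IsStronglyCartesian v f where
  toIsHomLift := hv
  universal_property' {e''} w g hg := by
    obtain ⟨⟩ := hv
    obtain ⟨h, ⟨h₁, h₂⟩, huniq⟩ := hf g w (IsHomLift.eq_of_isHomLift π (w ≫ π.map f) g)
    refine ⟨h, ⟨h₁ ▸ inferInstance, h₂⟩, fun k ⟨hk₁, hk₂⟩ => huniq k ⟨?_, hk₂⟩⟩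
    exact (IsHomLift.eq_of_isHomLift π w k).symm

theorem isCartesianMor_of_isStronglyCartesian {π : E ⥤ B} {e' e : E} {f : e' ⟶ e}
    {b' b : B} (v : b' ⟶ b) [hf : π.IsStronglyCartesian v f] : IsCartesianMor π f := by
  intro e'' g w hw
  obtain ⟨⟩ := hf.toIsHomLift
  have : π.IsHomLift (w ≫ π.map f) g := hw ▸ inferInstance
  obtain ⟨h, ⟨h₁, h₂⟩, huniq⟩ := hf.universal_property' w g
  exact ⟨h, ⟨(IsHomLift.eq_of_isHomLift π w h).symm, h₂⟩,
    fun k ⟨hk₁, hk₂⟩ => huniq k ⟨hk₁ ▸ inferInstance, hk₂⟩⟩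

theorem isStronglyCocartesian_of_isOpcartesianMor {π : E ⥤ B} {e e' : E} {f : e ⟶ e'}
    (hf : IsOpcartesianMor π f) {b b' : B} (u : b ⟶ b') [hu : π.IsHomLift u f] :
    π.IsStronglyCocartesian u f where
  toIsHomLift := hu
  universal_property' {e''} w g hg := by
    obtain ⟨⟩ := hu
    obtain ⟨h, ⟨h₁, h₂⟩, huniq⟩ := hf g w (IsHomLift.eq_of_isHomLift π (π.map f ≫ w) g)
    refine ⟨h, ⟨h₁ ▸ inferInstance, h₂⟩, fun k ⟨hk₁, hk₂⟩ => huniq k ⟨?_, hk₂⟩⟩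
    exact (IsHomLift.eq_of_isHomLift π w k).symm

theorem isOpcartesianMor_of_isStronglyCocartesian {π : E ⥤ B} {e e' : E} {f : e ⟶ e'}
    {b b' : B} (u : b ⟶ b') [hf : π.IsStronglyCocartesian u f] : IsOpcartesianMor π f := by
  intro e'' g w hw
  obtain ⟨⟩ := hf.toIsHomLift
  have : π.IsHomLift (π.map f ≫ w) g := hw ▸ inferInstance
  obtain ⟨h, ⟨h₁, h₂⟩, huniq⟩ := hf.universal_property' w g
  exact ⟨h, ⟨(IsHomLift.eq_of_isHomLift π w h).symm, h₂⟩,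
    fun k ⟨hk₁, hk₂⟩ => huniq k ⟨hk₁ ▸ inferInstance, hk₂⟩⟩

theorem IsVerticalMor.isHomLift {π : E ⥤ B} {e e' : E} {f : e ⟶ e'} (hf : IsVerticalMor π f)
    {b : B} (hb : π.obj e = b) : π.IsHomLift (𝟙 b) f := by
  obtain ⟨h, hf⟩ := hf
  exact IsHomLift.of_fac' π _ _ hb (h ▸ hb) (by simp [hf])

theorem isVerticalMor_of_isHomLift {π : E ⥤ B} {e e' : E} {f : e ⟶ e'} (b : B)
    [π.IsHomLift (𝟙 b) f] : IsVerticalMor π f :=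
  ⟨(IsHomLift.domain_eq π (𝟙 b) f).trans (IsHomLift.codomain_eq π (𝟙 b) f).symm,
    by simp [IsHomLift.fac' π (𝟙 b) f]⟩

theorem overSameArrow_of_isHomLift {π : E ⥤ B} {x y x' y' : E} (f : x ⟶ y) (g : x' ⟶ y')
    {b b' : B} (u : b ⟶ b') [π.IsHomLift u f] [π.IsHomLift u g] : OverSameArrow π f g :=
  ⟨(IsHomLift.domain_eq π u f).trans (IsHomLift.domain_eq π u g).symm,
    (IsHomLift.codomain_eq π u f).trans (IsHomLift.codomain_eq π u g).symm,
    by simp [IsHomLift.fac' π u f, IsHomLift.fac' π u g]⟩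

theorem isHomLift_of_vertical_comp (π : E ⥤ B) {x y z : E} (f : x ⟶ y) (g : y ⟶ z) {b b' : B}
    (u : b ⟶ b') [π.IsHomLift (𝟙 b) f] [π.IsHomLift u (f ≫ g)] : π.IsHomLift u g := by
  have h := IsHomLift.fac' π u (f ≫ g)
  rw [π.map_comp, IsHomLift.fac' π (𝟙 b) f] at h
  exact IsHomLift.of_fac' π _ _ (IsHomLift.codomain_eq π (𝟙 b) f)
    (IsHomLift.codomain_eq π u (f ≫ g)) (by simpa [eqToHom_comp_iff] using h)

theorem isHomLift_of_comp_vertical (π : E ⥤ B) {x y z : E} (f : x ⟶ y) (g : y ⟶ z) {b b' : B}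
    (u : b ⟶ b') [π.IsHomLift (𝟙 b') g] [π.IsHomLift u (f ≫ g)] : π.IsHomLift u f := by
  have h := IsHomLift.fac' π u (f ≫ g)
  rw [π.map_comp, IsHomLift.fac' π (𝟙 b') g] at h
  exact IsHomLift.of_fac' π _ _ (IsHomLift.domain_eq π u (f ≫ g))
    (IsHomLift.domain_eq π (𝟙 b') g) (by simpa [comp_eqToHom_iff] using h)

end HomLifts

section TwoSidedLifts

variable {E : Type u₁} [Category.{v₁} E] {A : Type u₂} [Category.{v₂} A]
  {B : Type u₃} [Category.{v₃} B] {ξ : E ⥤ A} {π : E ⥤ B}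

theorem CocartOnLeft.exists_lift (h : CocartOnLeft ξ π) {a a' : A} {b : B} (u : a ⟶ a') (e : E)
    (ha : ξ.obj e = a) (hb : π.obj e = b) :
    ∃ (e' : E) (f : e ⟶ e'), ξ.IsStronglyCocartesian u f ∧ π.IsHomLift (𝟙 b) f := by
  subst ha
  obtain ⟨e', f, ha', hf, hv, hu⟩ := h e u
  have : ξ.IsHomLift u f := IsHomLift.of_fac ξ _ _ rfl ha' (by simp [hu])
  exact ⟨e', f, isStronglyCocartesian_of_isOpcartesianMor hf u, hv.isHomLift hb⟩

theorem CartOnRight.exists_lift (h : CartOnRight ξ π) {a : A} {b b' : B} (v : b' ⟶ b) (e : E)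
    (ha : ξ.obj e = a) (hb : π.obj e = b) :
    ∃ (e' : E) (f : e' ⟶ e), π.IsStronglyCartesian v f ∧ ξ.IsHomLift (𝟙 a) f := by
  subst hb
  obtain ⟨e', f, hb', hf, hv, hu⟩ := h e v
  have : π.IsHomLift v f := IsHomLift.of_fac π _ _ hb' rfl (by simp [← hu])
  exact ⟨e', f, isStronglyCartesian_of_isCartesianMor hf v,
    hv.isHomLift (hv.choose.trans ha)⟩

/-- In a two-sided fibration, the morphism induced between the cocartesian pushforwards along `u`
by a cartesian lift of `v` is again a cartesian lift of `v`. -/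
theorem IsTwoSidedFib.isStronglyCartesian_of_square (h2s : IsTwoSidedFib ξ π)
    {a a' : A} {b b' : B} (u : a ⟶ a') (v : b ⟶ b') {x x' y y' : E}
    (f : x ⟶ y) (k : x' ⟶ y') (k' : x ⟶ x') (g : y ⟶ y') (comm : f ≫ g = k' ≫ k)
    [ξ.IsStronglyCocartesian u f] [π.IsHomLift (𝟙 b) f]
    [ξ.IsStronglyCocartesian u k] [π.IsHomLift (𝟙 b') k]
    [π.IsStronglyCartesian v k'] [ξ.IsHomLift (𝟙 a) k']
    [π.IsHomLift v g] [ξ.IsHomLift (𝟙 a') g] : π.IsStronglyCartesian v g := by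
  obtain ⟨z, f', hf', hf'v⟩ := h2s.2.1.exists_lift v y'
    (IsHomLift.codomain_eq ξ u k) (IsHomLift.codomain_eq π (𝟙 b') k)
  let h : y ⟶ z := Functor.IsStronglyCartesian.map π v f' (g := 𝟙 b) (f' := v) (by simp) g
  have hh : h ≫ f' = g := by simp [h]
  have : π.IsHomLift (𝟙 b) h := by dsimp only [h]; infer_instance
  have : ξ.IsHomLift (𝟙 a') (h ≫ f') := hh ▸ inferInstance
  have : ξ.IsHomLift (𝟙 a') h := isHomLift_of_comp_vertical ξ h f' (𝟙 a')
  have : IsIso h := h2s.2.2 k k' f f' g h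
    (isOpcartesianMor_of_isStronglyCocartesian u) (isVerticalMor_of_isHomLift b')
    (isCartesianMor_of_isStronglyCartesian v) (isVerticalMor_of_isHomLift a)
    (isOpcartesianMor_of_isStronglyCocartesian u) (isVerticalMor_of_isHomLift b)
    (overSameArrow_of_isHomLift _ _ u)
    (isCartesianMor_of_isStronglyCartesian v) (isVerticalMor_of_isHomLift a')
    (overSameArrow_of_isHomLift _ _ v)
    (isVerticalMor_of_isHomLift a') comm (isVerticalMor_of_isHomLift a')
    (isVerticalMor_of_isHomLift b) hh
  have := Functor.IsStronglyCartesian.comp (p := π) (f := 𝟙 b) (g := v) (φ := h) (ψ := f')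
  rwa [Category.id_comp, hh] at this

end TwoSidedLifts

section Sections

variable {E : Type u₁} [Category.{v₁} E] {A : Type u₂} [Category.{v₂} A]
  {B : Type u₃} [Category.{v₃} B] {ξ : E ⥤ A} {π : E ⥤ B}

namespace TwoSect

variable (X : TwoSect ξ π)

instance isHomLift_fst {p q : A × B} (f : p ⟶ q) : ξ.IsHomLift f.1 (X.σ.map f) :=
  IsHomLift.of_fac' ξ _ _ (congrArg Prod.fst (Functor.congr_obj X.sect p))
    (congrArg Prod.fst (Functor.congr_obj X.sect q))
    (by simpa using congrArg Prod.fst (Functor.congr_hom X.sect f))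

instance isHomLift_snd {p q : A × B} (f : p ⟶ q) : π.IsHomLift f.2 (X.σ.map f) :=
  IsHomLift.of_fac' π _ _ (congrArg Prod.snd (Functor.congr_obj X.sect p))
    (congrArg Prod.snd (Functor.congr_obj X.sect q))
    (by simpa using congrArg Prod.snd (Functor.congr_hom X.sect f))

/-- The cocartesian morphism `σ(a, b) ⟶ σ(a', b)` over `u`. -/
def push {a a' : A} (u : a ⟶ a') (b : B) : X.σ.obj (a, b) ⟶ X.σ.obj (a', b) :=
  X.σ.map ((u, 𝟙 b) : (a, b) ⟶ (a', b))

/-- The cartesian morphism `σ(a, b) ⟶ σ(a, b')` over `v`. -/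
def pull (a : A) {b b' : B} (v : b ⟶ b') : X.σ.obj (a, b) ⟶ X.σ.obj (a, b') :=
  X.σ.map ((𝟙 a, v) : (a, b) ⟶ (a, b'))

instance push_fst {a a' : A} (u : a ⟶ a') (b : B) : ξ.IsStronglyCocartesian u (X.push u b) :=
  haveI : ξ.IsHomLift u (X.σ.map ((u, 𝟙 b) : (a, b) ⟶ (a', b))) :=
    X.isHomLift_fst ((u, 𝟙 b) : (a, b) ⟶ (a', b))
  isStronglyCocartesian_of_isOpcartesianMor (X.opcart u b) u

instance push_snd {a a' : A} (u : a ⟶ a') (b : B) : π.IsHomLift (𝟙 b) (X.push u b) :=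
  X.isHomLift_snd ((u, 𝟙 b) : (a, b) ⟶ (a', b))

instance pull_snd (a : A) {b b' : B} (v : b ⟶ b') : π.IsStronglyCartesian v (X.pull a v) :=
  haveI : π.IsHomLift v (X.σ.map ((𝟙 a, v) : (a, b) ⟶ (a, b'))) :=
    X.isHomLift_snd ((𝟙 a, v) : (a, b) ⟶ (a, b'))
  isStronglyCartesian_of_isCartesianMor (X.cart a v) v

instance pull_fst (a : A) {b b' : B} (v : b ⟶ b') : ξ.IsHomLift (𝟙 a) (X.pull a v) :=
  X.isHomLift_fst ((𝟙 a, v) : (a, b) ⟶ (a, b'))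

theorem push_map {a₀ a a' : A} {b b' : B} (i : a₀ ⟶ a) (i' : a₀ ⟶ a') (u : a ⟶ a') (v : b ⟶ b')
    (hi : i ≫ u = i') :
    X.push i b ≫ X.σ.map ((u, v) : (a, b) ⟶ (a', b')) = X.pull a₀ v ≫ X.push i' b' := by
  rw [push, push, pull, ← X.σ.map_comp, ← X.σ.map_comp]
  congr 1
  ext <;> simp [hi]

theorem pull_pull (a : A) {b b' b'' : B} (v : b ⟶ b') (w : b' ⟶ b'') :
    X.pull a v ≫ X.pull a w = X.pull a (v ≫ w) := by
  rw [pull, pull, pull, ← X.σ.map_comp]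
  congr 1
  ext <;> simp

@[simp]
theorem push_id (a : A) (b : B) : X.push (𝟙 a) b = 𝟙 _ := X.σ.map_id (a, b)

@[simp]
theorem pull_id (a : A) (b : B) : X.pull a (𝟙 b) = 𝟙 _ := X.σ.map_id (a, b)

theorem obj_fst (p : A × B) : ξ.obj (X.σ.obj p) = p.1 :=
  congrArg Prod.fst (Functor.congr_obj X.sect p)

theorem obj_snd (p : A × B) : π.obj (X.σ.obj p) = p.2 :=
  congrArg Prod.snd (Functor.congr_obj X.sect p)

end TwoSect

namespace TwoSectHom

variable {X Y : TwoSect ξ π} (f : TwoSectHom X Y)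

instance isHomLift_fst (a : A) (b : B) : ξ.IsHomLift (𝟙 a) (f.μ.app (a, b)) :=
  (f.vertL (a, b)).isHomLift (X.obj_fst (a, b))

instance isHomLift_snd (a : A) (b : B) : π.IsHomLift (𝟙 b) (f.μ.app (a, b)) :=
  (f.vertR (a, b)).isHomLift (X.obj_snd (a, b))

theorem push_app {a a' : A} (u : a ⟶ a') (b : B) :
    X.push u b ≫ f.μ.app (a', b) = f.μ.app (a, b) ≫ Y.push u b :=
  f.μ.naturality _

theorem pull_app (a : A) {b b' : B} (v : b ⟶ b') :
    X.pull a v ≫ f.μ.app (a, b') = f.μ.app (a, b) ≫ Y.pull a v :=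
  f.μ.naturality _

/-- A morphism of two-sided sections is determined by its value at an initial-terminal pair. -/
theorem ext_of_app_eq {a₀ : A} (ha₀ : Limits.IsInitial a₀) {b₀ : B} (hb₀ : Limits.IsTerminal b₀)
    {f g : TwoSectHom X Y} (h : f.μ.app (a₀, b₀) = g.μ.app (a₀, b₀)) : f = g := by
  apply TwoSectHom.ext'
  ext ⟨a, b⟩
  have key : f.μ.app (a₀, b) = g.μ.app (a₀, b) :=
    Functor.IsStronglyCartesian.ext π (hb₀.from b) (Y.pull a₀ (hb₀.from b)) (𝟙 b)
      (by rw [← pull_app, ← pull_app, h])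
  exact Functor.IsStronglyCocartesian.ext ξ (ha₀.to a) (X.push (ha₀.to a) b) (𝟙 a)
    (by rw [push_app, push_app, key])

/-- A bivertical morphism between the values of two sections at an initial-terminal pair extends
to a morphism of sections. -/
theorem exists_app_eq {a₀ : A} (ha₀ : Limits.IsInitial a₀) {b₀ : B} (hb₀ : Limits.IsTerminal b₀)
    (X Y : TwoSect ξ π) (φ : X.σ.obj (a₀, b₀) ⟶ Y.σ.obj (a₀, b₀))
    [hL : ξ.IsHomLift (𝟙 a₀) φ] [hR : π.IsHomLift (𝟙 b₀) φ] :
    ∃ f : TwoSectHom X Y, f.μ.app (a₀, b₀) = φ := by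
  have exists_m (b : B) : ∃ m : X.σ.obj (a₀, b) ⟶ Y.σ.obj (a₀, b),
      ξ.IsHomLift (𝟙 a₀) m ∧ π.IsHomLift (𝟙 b) m ∧
        m ≫ Y.pull a₀ (hb₀.from b) = X.pull a₀ (hb₀.from b) ≫ φ := by
    obtain ⟨m, ⟨hm, hm'⟩, -⟩ := Functor.IsStronglyCartesian.universal_property π (hb₀.from b)
      (Y.pull a₀ (hb₀.from b)) (𝟙 b) (hb₀.from b) (by simp) (X.pull a₀ (hb₀.from b) ≫ φ)
    have : ξ.IsHomLift (𝟙 a₀) (m ≫ Y.pull a₀ (hb₀.from b)) := hm' ▸ inferInstance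
    exact ⟨m, isHomLift_of_comp_vertical ξ m (Y.pull a₀ (hb₀.from b)) (𝟙 a₀), hm, hm'⟩
  choose m hmL hmR hm using exists_m
  have exists_n (p : A × B) : ∃ n : X.σ.obj p ⟶ Y.σ.obj p,
      ξ.IsHomLift (𝟙 p.1) n ∧ π.IsHomLift (𝟙 p.2) n ∧
        X.push (ha₀.to p.1) p.2 ≫ n = m p.2 ≫ Y.push (ha₀.to p.1) p.2 := by
    obtain ⟨a, b⟩ := p
    obtain ⟨n, ⟨hn, hn'⟩, -⟩ := Functor.IsStronglyCocartesian.universal_property ξ (ha₀.to a)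
      (X.push (ha₀.to a) b) (𝟙 a) (ha₀.to a) (by simp) (m b ≫ Y.push (ha₀.to a) b)
    have : π.IsHomLift (𝟙 b) (X.push (ha₀.to a) b ≫ n) := hn' ▸ inferInstance
    exact ⟨n, hn, isHomLift_of_vertical_comp π (X.push (ha₀.to a) b) n (𝟙 b), hn'⟩
  choose n hnL hnR hn using exists_n
  have m_nat {b b' : B} (v : b ⟶ b') : X.pull a₀ v ≫ m b' = m b ≫ Y.pull a₀ v :=
    Functor.IsStronglyCartesian.ext π (hb₀.from b') (Y.pull a₀ (hb₀.from b')) v (by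
      rw [Category.assoc, Category.assoc, hm, Y.pull_pull, ← Category.assoc, X.pull_pull,
        hb₀.hom_ext (v ≫ hb₀.from b') (hb₀.from b), hm])
  refine ⟨⟨⟨n, ?_⟩, fun p => isVerticalMor_of_isHomLift p.1,
    fun p => isVerticalMor_of_isHomLift p.2⟩, ?_⟩
  · rintro ⟨a, b⟩ ⟨a', b'⟩ ⟨u, v⟩
    have hX := X.push_map (ha₀.to a) (ha₀.to a') u v (ha₀.hom_ext _ _)
    have hY := Y.push_map (ha₀.to a) (ha₀.to a') u v (ha₀.hom_ext _ _)
    have : ξ.IsHomLift u (X.σ.map ((u, v) : (a, b) ⟶ (a', b'))) := X.isHomLift_fst ((u, v) : (a, b) ⟶ (a', b'))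
    have : ξ.IsHomLift u (Y.σ.map ((u, v) : (a, b) ⟶ (a', b'))) := Y.isHomLift_fst ((u, v) : (a, b) ⟶ (a', b'))
    have := hnL (a, b)
    have := hnL (a', b')
    have h₁ := hn (a, b)
    have h₂ := hn (a', b')
    dsimp only at *
    refine Functor.IsStronglyCocartesian.ext ξ (ha₀.to a) (X.push (ha₀.to a) b) u ?_
    rw [reassoc_of% hX, h₂, reassoc_of% h₁, hY, reassoc_of% (m_nat v)]
  · have h₁ := hn (a₀, b₀)
    have h₂ := hm b₀
    simp only [hb₀.hom_ext (hb₀.from b₀) (𝟙 b₀), ha₀.hom_ext (ha₀.to a₀) (𝟙 a₀), TwoSect.push_id,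
      TwoSect.pull_id, Category.id_comp, Category.comp_id] at h₁ h₂
    exact h₁.trans h₂

end TwoSectHom

/-- Every object of the bifiber over an initial-terminal pair is, up to a bivertical isomorphism,
the value of a two-sided cartesian section. -/
theorem IsTwoSidedFib.exists_twoSect (h2s : IsTwoSidedFib ξ π)
    {a₀ : A} (ha₀ : Limits.IsInitial a₀) {b₀ : B} (hb₀ : Limits.IsTerminal b₀) (e : E)
    (ha : ξ.obj e = a₀) (hb : π.obj e = b₀) :
    ∃ (X : TwoSect ξ π) (i : X.σ.obj (a₀, b₀) ≅ e),
      ξ.IsHomLift (𝟙 a₀) i.hom ∧ π.IsHomLift (𝟙 b₀) i.hom := by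
  choose x c hcR hcL using fun b => h2s.2.1.exists_lift (hb₀.from b) e ha hb
  choose y d hdL hdR using fun p : A × B => h2s.1.exists_lift (ha₀.to p.1) (x p.2)
    (IsHomLift.domain_eq ξ (𝟙 a₀) (c p.2)) (IsHomLift.domain_eq π (hb₀.from p.2) (c p.2))
  have exists_xm {b b' : B} (v : b ⟶ b') : ∃ k : x b ⟶ x b',
      π.IsStronglyCartesian v k ∧ ξ.IsHomLift (𝟙 a₀) k ∧ k ≫ c b' = c b := by
    obtain ⟨k, ⟨hk, hk'⟩, -⟩ := Functor.IsStronglyCartesian.universal_property π (hb₀.from b')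
      (c b') v (hb₀.from b) (hb₀.hom_ext _ _) (c b)
    have : ξ.IsHomLift (𝟙 a₀) (k ≫ c b') := hk' ▸ inferInstance
    have : π.IsStronglyCartesian (v ≫ hb₀.from b') (k ≫ c b') := by
      rw [hk', hb₀.hom_ext (v ≫ hb₀.from b') (hb₀.from b)]
      infer_instance
    exact ⟨k, Functor.IsStronglyCartesian.of_comp π (g := hb₀.from b') (ψ := c b'),
      isHomLift_of_comp_vertical ξ k (c b') (𝟙 a₀), hk'⟩
  choose xm hxmR hxmL hxm using @exists_xm
  have xm_ext {b b' : B} (v : b ⟶ b') (k : x b ⟶ x b') (hk : π.IsHomLift v k)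
      (hk' : k ≫ c b' = c b) : xm v = k :=
    Functor.IsStronglyCartesian.ext π (hb₀.from b') (c b') v (by rw [hxm, hk'])
  have exists_ym {p q : A × B} (f : p ⟶ q) : ∃ k : y p ⟶ y q,
      ξ.IsHomLift f.1 k ∧ π.IsHomLift f.2 k ∧ d p ≫ k = xm f.2 ≫ d q := by
    obtain ⟨k, ⟨hk, hk'⟩, -⟩ := Functor.IsStronglyCocartesian.universal_property ξ (ha₀.to p.1)
      (d p) f.1 (ha₀.to q.1) (ha₀.hom_ext _ _) (xm f.2 ≫ d q)
    have : π.IsHomLift f.2 (d p ≫ k) := hk' ▸ inferInstance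
    exact ⟨k, hk, isHomLift_of_vertical_comp π (d p) k f.2, hk'⟩
  choose ym hymL hymR hym using @exists_ym
  have ym_ext {p q : A × B} (f : p ⟶ q) (k : y p ⟶ y q) (hk : ξ.IsHomLift f.1 k)
      (hk' : d p ≫ k = xm f.2 ≫ d q) : ym f = k :=
    Functor.IsStronglyCocartesian.ext ξ (ha₀.to p.1) (d p) f.1 (by rw [hym, hk'])
  have xm_id (b : B) : xm (𝟙 b) = 𝟙 (x b) :=
    xm_ext _ _ (IsHomLift.id (IsHomLift.domain_eq π (hb₀.from b) (c b))) (by simp)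
  have xm_comp {b b' b'' : B} (v : b ⟶ b') (w : b' ⟶ b'') : xm (v ≫ w) = xm v ≫ xm w :=
    xm_ext _ _ inferInstance (by simp [hxm])
  have y_fst (p : A × B) : ξ.obj (y p) = p.1 := IsHomLift.codomain_eq ξ (ha₀.to p.1) (d p)
  have y_snd (p : A × B) : π.obj (y p) = p.2 := IsHomLift.codomain_eq π (𝟙 p.2) (d p)
  let σ : A × B ⥤ E :=
    { obj := y
      map := ym
      map_id := fun p => ym_ext _ _ (IsHomLift.id (y_fst p)) (by simp [xm_id])
      map_comp := fun {p q r} f g => ym_ext _ _ (IsHomLift.comp ξ f.1 g.1 (ym f) (ym g)) (by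
        rw [← Category.assoc, hym, Category.assoc, hym, ← Category.assoc, ← xm_comp]; rfl) }
  have sect : σ ⋙ ξ.prod' π = 𝟭 (A × B) :=
    CategoryTheory.Functor.ext (fun p => Prod.ext (y_fst p) (y_snd p)) (fun p q f => by
      ext
      · simpa using IsHomLift.fac' ξ f.1 (ym f)
      · simpa using IsHomLift.fac' π f.2 (ym f))
  let X : TwoSect ξ π :=
    { σ := σ
      sect := sect
      opcart := fun a a' u b => by
        let f : (a, b) ⟶ (a', b) := (u, 𝟙 b)
        have : ξ.IsHomLift u (ym f) := hymL f
        have hd := hdL (a, b)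
        have hd' := hdL (a', b)
        dsimp only at hd hd'
        have : ξ.IsStronglyCocartesian (ha₀.to a ≫ u) (d (a, b) ≫ ym f) := by
          rw [hym f, xm_id, Category.id_comp, ha₀.hom_ext (ha₀.to a ≫ u) (ha₀.to a')]
          exact hd'
        have : ξ.IsStronglyCocartesian u (ym f) :=
          Functor.IsStronglyCocartesian.of_comp ξ (f := ha₀.to a) (φ := d (a, b))
        exact isOpcartesianMor_of_isStronglyCocartesian u
      cart := fun a b b' v => by
        let f : (a, b) ⟶ (a, b') := (𝟙 a, v)
        have := hymL f
        have := hymR f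
        have := hdL (a, b)
        have := hdL (a, b')
        have := hdR (a, b)
        have := hdR (a, b')
        dsimp only [f] at *
        have : π.IsStronglyCartesian v (ym f) :=
          h2s.isStronglyCartesian_of_square (ha₀.to a) v (d (a, b)) (d (a, b')) (xm v) (ym f)
            (hym f)
        exact isCartesianMor_of_isStronglyCartesian v }
  have hd : ξ.IsStronglyCocartesian (𝟙 a₀) (d (a₀, b₀)) :=
    ha₀.hom_ext (ha₀.to a₀) (𝟙 a₀) ▸ hdL (a₀, b₀)
  have hc : π.IsStronglyCartesian (𝟙 b₀) (c b₀) := hb₀.hom_ext (hb₀.from b₀) (𝟙 b₀) ▸ hcR b₀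
  have hdR₀ : π.IsHomLift (𝟙 b₀) (d (a₀, b₀)) := hdR (a₀, b₀)
  have : IsIso (d (a₀, b₀)) := Functor.IsStronglyCocartesian.isIso_of_base_isIso ξ (𝟙 a₀) _
  have : IsIso (c b₀) := Functor.IsStronglyCartesian.isIso_of_base_isIso π (𝟙 b₀) _
  refine ⟨X, (asIso (d (a₀, b₀))).symm ≪≫ asIso (c b₀), ?_, ?_⟩
  · refine @isHomLift_of_vertical_comp _ _ _ _ ξ _ _ _ (d (a₀, b₀)) _ _ _ (𝟙 a₀) inferInstance ?_
    simpa using hcL b₀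
  · refine @isHomLift_of_vertical_comp _ _ _ _ π _ _ _ (d (a₀, b₀)) _ _ _ (𝟙 b₀) inferInstance ?_
    simpa using hc.toIsHomLift

/-- A bivertical isomorphism is an isomorphism in the bifiber. -/
def BiFiberCat.isoMk {a : A} {b : B} {X Y : BiFiberCat ξ π a b} (i : X.e ≅ Y.e)
    (hi : ξ.IsHomLift (𝟙 a) i.hom) (hi' : π.IsHomLift (𝟙 b) i.hom) : X ≅ Y where
  hom := ⟨i.hom, by simp [IsHomLift.fac' ξ (𝟙 a) i.hom], by simp [IsHomLift.fac' π (𝟙 b) i.hom]⟩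
  inv := ⟨i.inv, by simp [IsHomLift.fac' ξ (𝟙 a) i.inv], by simp [IsHomLift.fac' π (𝟙 b) i.inv]⟩
  hom_inv_id := BiFiberHom.ext' i.hom_inv_id
  inv_hom_id := BiFiberHom.ext' i.inv_hom_id

end Sections

section Statement18

variable {E : Type u₁} [Category.{v₁} E] {A : Type u₂} [Category.{v₂} A]
  {B : Type u₃} [Category.{v₃} B]

/-- **Two-sided fibrations over a base with an initial and a terminal object.** If
`⟨ξ,π⟩ : E ⥤ A × B` is a two-sided fibration, `a₀` is initial in `A` and `b₀` is
terminal in `B`, then evaluation at `(a₀,b₀)` is an equivalence from the category of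
two-sided cartesian sections to the bifiber `E_(a₀,b₀)`. -/
theorem twoSectEval_isEquivalence (ξ : E ⥤ A) (π : E ⥤ B)
    (h2s : IsTwoSidedFib ξ π)
    {a₀ : A} (ha₀ : Limits.IsInitial a₀) {b₀ : B} (hb₀ : Limits.IsTerminal b₀) :
    (twoSectEval ξ π a₀ b₀).IsEquivalence := by
  have : (twoSectEval ξ π a₀ b₀).Faithful :=
    ⟨fun h => TwoSectHom.ext_of_app_eq ha₀ hb₀ (congrArg BiFiberHom.f h)⟩
  have : (twoSectEval ξ π a₀ b₀).Full := by
    refine ⟨fun {X Y} φ => ?_⟩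
    obtain ⟨f, hf⟩ := TwoSectHom.exists_app_eq ha₀ hb₀ X Y φ.f
      (hL := IsVerticalMor.isHomLift ⟨_, φ.wa⟩ (X.obj_fst (a₀, b₀)))
      (hR := IsVerticalMor.isHomLift ⟨_, φ.wb⟩ (X.obj_snd (a₀, b₀)))
    exact ⟨f, BiFiberHom.ext' hf⟩
  have : (twoSectEval ξ π a₀ b₀).EssSurj := by
    refine ⟨fun Z => ?_⟩
    obtain ⟨X, i, hi, hi'⟩ := h2s.exists_twoSect ha₀ hb₀ Z.e Z.ha Z.hb
    exact ⟨X, ⟨BiFiberCat.isoMk i hi hi'⟩⟩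
  exact {}

end Statement18
end

section
/- Let A and B be categories, let a be an object of A and b an object of B, and let a\A denote the coslice category of objects under a and B/b the slice category of objects over b (in which id_a is an initial object and id_b is a terminal object, respectively). For any two-sided fibration ⟨ξ,π⟩ : Q ⥤ (a\A) × (B/b), the evaluation functor TwoSect(Q) ⥤ Q_(id_a, id_b), sending a two-sided cartesian section σ to σ(id_a, id_b) and a vertical natural transformation to its component at (id_a, id_b), is an equivalence of categories. (Dependent Yoneda Lemma for two-sided fibrations.) -/
open CategoryTheory

universe w v₁ u₁ v₂ u₂ v₃ u₃ v₄ u₄ v₅ u₅ v₆ u₆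

section CartesianMorphisms

variable {E : Type u₁} [Category.{v₁} E] {B : Type u₂} [Category.{v₂} B] {π : E ⥤ B}

theorem IsOpcartesianMor.hom_ext {e e' e'' : E} {f : e ⟶ e'} (hf : IsOpcartesianMor π f)
    {h h' : e' ⟶ e''} (hπ : π.map h = π.map h') (hc : f ≫ h = f ≫ h') : h = h' :=
  (hf (f ≫ h') (π.map h') (π.map_comp _ _).symm).unique ⟨hπ, hc⟩ ⟨rfl, rfl⟩

theorem IsCartesianMor.hom_ext {e e' e'' : E} {f : e' ⟶ e} (hf : IsCartesianMor π f)
    {h h' : e'' ⟶ e'} (hπ : π.map h = π.map h') (hc : h ≫ f = h' ≫ f) : h = h' :=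
  (hf (h' ≫ f) (π.map h') (π.map_comp _ _).symm).unique ⟨hπ, hc⟩ ⟨rfl, rfl⟩

theorem IsOpcartesianMor.of_comp {x y z : E} {f : x ⟶ y} {g : y ⟶ z}
    (hf : IsOpcartesianMor π f) (hfg : IsOpcartesianMor π (f ≫ g)) :
    IsOpcartesianMor π g := by
  intro e q w hw
  obtain ⟨h, ⟨hπ, hc⟩, -⟩ := hfg (f ≫ q) w (by simp [hw])
  refine ⟨h, ⟨hπ, hf.hom_ext (by simp [hπ, hw]) (by simpa using hc)⟩, ?_⟩
  rintro h' ⟨hπ', hc'⟩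
  exact hfg.hom_ext (hπ'.trans hπ.symm) (by rw [hc, Category.assoc, hc'])

theorem IsCartesianMor.of_comp {x y z : E} {f : x ⟶ y} {g : y ⟶ z}
    (hg : IsCartesianMor π g) (hfg : IsCartesianMor π (f ≫ g)) :
    IsCartesianMor π f := by
  intro e q w hw
  obtain ⟨h, ⟨hπ, hc⟩, -⟩ := hfg (q ≫ g) w (by simp [← hw])
  refine ⟨h, ⟨hπ, hg.hom_ext (by simp [hπ, hw]) (by simpa using hc)⟩, ?_⟩
  rintro h' ⟨hπ', hc'⟩
  exact hfg.hom_ext (hπ'.trans hπ.symm) (by rw [hc, ← Category.assoc, hc'])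

theorem IsOpcartesianMor.comp_isIso {x y z : E} {f : x ⟶ y} (hf : IsOpcartesianMor π f)
    (g : y ⟶ z) [IsIso g] : IsOpcartesianMor π (f ≫ g) := by
  intro e q w hw
  obtain ⟨h, ⟨hπ, hc⟩, -⟩ := hf q (π.map g ≫ w) (by simpa using hw)
  refine ⟨inv g ≫ h, ⟨by simp [hπ], by simp [hc]⟩, ?_⟩
  rintro h' ⟨hπ', hc'⟩
  rw [IsIso.eq_inv_comp]
  exact hf.hom_ext (by simp [hπ, hπ']) (by simpa [hc] using hc')

theorem IsOpcartesianMor.isIso {x y : E} {f : x ⟶ y} (hf : IsOpcartesianMor π f)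
    [IsIso (π.map f)] : IsIso f := by
  obtain ⟨h, ⟨hπ, hc⟩, -⟩ := hf (𝟙 x) (inv (π.map f)) (by simp)
  exact ⟨h, hc, hf.hom_ext (by simp [hπ]) (by simp [reassoc_of% hc])⟩

theorem IsCartesianMor.isIso {x y : E} {f : x ⟶ y} (hf : IsCartesianMor π f)
    [IsIso (π.map f)] : IsIso f := by
  obtain ⟨h, ⟨hπ, hc⟩, -⟩ := hf (𝟙 y) (inv (π.map f)) (by simp)
  exact ⟨h, hf.hom_ext (by simp [hπ]) (by simp [hc]), hc⟩

end CartesianMorphisms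

section TwoSidedSections

open Limits

variable {E : Type u₁} [Category.{v₁} E] {A : Type u₂} [Category.{v₂} A]
  {B : Type u₃} [Category.{v₃} B] {ξ : E ⥤ A} {π : E ⥤ B}

theorem BiFiberCat.nonempty_iso {a : A} {b : B} {X Y : BiFiberCat ξ π a b} (f : X ⟶ Y)
    [IsIso f.f] : Nonempty (X ≅ Y) :=
  ⟨{ hom := f
     inv := ⟨inv f.f, by simp [f.wa], by simp [f.wb]⟩
     hom_inv_id := BiFiberHom.ext' (IsIso.hom_inv_id f.f)
     inv_hom_id := BiFiberHom.ext' (IsIso.inv_hom_id f.f) }⟩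

namespace TwoSect

theorem obj_left (X : TwoSect ξ π) (p : A × B) : ξ.obj (X.σ.obj p) = p.1 :=
  congrArg Prod.fst (Functor.congr_obj X.sect p)

theorem obj_right (X : TwoSect ξ π) (p : A × B) : π.obj (X.σ.obj p) = p.2 :=
  congrArg Prod.snd (Functor.congr_obj X.sect p)

theorem map_left (X : TwoSect ξ π) {p q : A × B} (m : p ⟶ q) :
    ξ.map (X.σ.map m) = eqToHom (X.obj_left p) ≫ m.1 ≫ eqToHom (X.obj_left q).symm := by
  simpa using congrArg (fun n => n.1) (Functor.congr_hom X.sect m)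

theorem map_right (X : TwoSect ξ π) {p q : A × B} (m : p ⟶ q) :
    π.map (X.σ.map m) = eqToHom (X.obj_right p) ≫ m.2 ≫ eqToHom (X.obj_right q).symm := by
  simpa using congrArg (fun n => n.2) (Functor.congr_hom X.sect m)

theorem hom_map_left {X Y : TwoSect ξ π} (f : X ⟶ Y) (p : A × B) :
    ξ.map (f.μ.app p) = eqToHom ((X.obj_left p).trans (Y.obj_left p).symm) :=
  (f.vertL p).choose_spec

theorem hom_map_right {X Y : TwoSect ξ π} (f : X ⟶ Y) (p : A × B) :
    π.map (f.μ.app p) = eqToHom ((X.obj_right p).trans (Y.obj_right p).symm) :=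
  (f.vertR p).choose_spec

end TwoSect

/-- An object of the base equal to an initial object is initial. -/
def isInitialOfEq {i x : A} (hi : IsInitial i) (h : x = i) : IsInitial x :=
  hi.ofIso (eqToIso h.symm)

/-- An object of the base equal to a terminal object is terminal. -/
def isTerminalOfEq {t y : B} (ht : IsTerminal t) (h : y = t) : IsTerminal y :=
  ht.ofIso (eqToIso h.symm)

theorem twoSectEval_faithful {i : A} {t : B} (hi : IsInitial i) (ht : IsTerminal t) :
    (twoSectEval ξ π i t).Faithful := by
  refine ⟨fun {X Y} f g hfg => TwoSectHom.ext' ?_⟩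
  have h₀ : f.μ.app (i, t) = g.μ.app (i, t) := congrArg BiFiberHom.f hfg
  have h₁ (x : A) : f.μ.app (x, t) = g.μ.app (x, t) := by
    refine (X.opcart (hi.to x) t).hom_ext ?_ ?_
    · rw [TwoSect.hom_map_left, TwoSect.hom_map_left]
    · rw [f.μ.naturality, g.μ.naturality, h₀]
  ext ⟨x, y⟩
  refine (Y.cart x (ht.from y)).hom_ext ?_ ?_
  · rw [TwoSect.hom_map_right, TwoSect.hom_map_right]
  · rw [← f.μ.naturality, ← g.μ.naturality, h₁]

theorem twoSectEval_full {i : A} {t : B} (hi : IsInitial i) (ht : IsTerminal t) :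
    (twoSectEval ξ π i t).Full := by
  refine ⟨fun {X Y} f => ?_⟩
  obtain ⟨f₀, hf₀⟩ : ∃ f₀ : X.σ.obj (i, t) ⟶ Y.σ.obj (i, t), f₀ = f.f := ⟨f.f, rfl⟩
  have hm (x : A) : ∃ m : X.σ.obj (x, t) ⟶ Y.σ.obj (x, t),
      ξ.map m = eqToHom ((X.obj_left _).trans (Y.obj_left _).symm) ∧
      X.σ.map ((hi.to x, 𝟙 t) : (i, t) ⟶ (x, t)) ≫ m =
        f₀ ≫ Y.σ.map ((hi.to x, 𝟙 t) : (i, t) ⟶ (x, t)) :=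
    (X.opcart (hi.to x) t _ _
      ((isInitialOfEq hi (X.obj_left (i, t))).hom_ext _ _)).exists
  choose m hmξ hmc using hm
  have hn (p : A × B) : ∃ n : X.σ.obj p ⟶ Y.σ.obj p,
      π.map n = eqToHom ((X.obj_right _).trans (Y.obj_right _).symm) ∧
      n ≫ Y.σ.map ((𝟙 p.1, ht.from p.2) : p ⟶ (p.1, t)) =
        X.σ.map ((𝟙 p.1, ht.from p.2) : p ⟶ (p.1, t)) ≫ m p.1 :=
    (Y.cart p.1 (ht.from p.2) _ _
      ((isTerminalOfEq ht (Y.obj_right (p.1, t))).hom_ext _ _)).exists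
  choose n hnπ hnc using hn
  have hm_nat {x x' : A} (u : x ⟶ x') :
      X.σ.map ((u, 𝟙 t) : (x, t) ⟶ (x', t)) ≫ m x' =
        m x ≫ Y.σ.map ((u, 𝟙 t) : (x, t) ⟶ (x', t)) := by
    refine (X.opcart (hi.to x) t).hom_ext ?_ ?_
    · simp [hmξ, TwoSect.map_left]
    · have hu : CategoryStruct.comp (X := (i, t)) (Y := (x, t)) (Z := (x', t))
          (hi.to x, 𝟙 t) (u, 𝟙 t) = (hi.to x', 𝟙 t) := by
        ext
        · exact hi.hom_ext _ _
        · exact Category.comp_id _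
      rw [← Category.assoc, ← X.σ.map_comp, hu, hmc, ← Category.assoc, hmc,
        Category.assoc, ← Y.σ.map_comp, hu]
  have hnξ (p : A × B) :
      ξ.map (n p) = eqToHom ((X.obj_left _).trans (Y.obj_left _).symm) := by
    have h := congrArg ξ.map (hnc p)
    simp only [Functor.map_comp, TwoSect.map_left, hmξ, Category.id_comp, eqToHom_trans] at h
    simpa using h =≫ eqToHom ((Y.obj_left (p.1, t)).trans (Y.obj_left p).symm)
  refine ⟨⟨⟨n, fun p q r => ?_⟩, fun p => ⟨_, hnξ p⟩, fun p => ⟨_, hnπ p⟩⟩,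
    BiFiberHom.ext' ?_⟩
  · refine (Y.cart q.1 (ht.from q.2)).hom_ext ?_ ?_
    · simp [hnπ, TwoSect.map_right]
    · have hr : r ≫ ((𝟙 q.1, ht.from q.2) : q ⟶ (q.1, t)) =
          ((𝟙 p.1, ht.from p.2) : p ⟶ (p.1, t)) ≫ ((r.1, 𝟙 t) : (p.1, t) ⟶ (q.1, t)) :=
        Prod.ext (by simp) (ht.hom_ext _ _)
      calc (X.σ.map r ≫ n q) ≫ Y.σ.map ((𝟙 q.1, ht.from q.2) : q ⟶ (q.1, t))
          = X.σ.map (r ≫ ((𝟙 q.1, ht.from q.2) : q ⟶ (q.1, t))) ≫ m q.1 := by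
            rw [Category.assoc, hnc, ← Category.assoc, ← X.σ.map_comp]
        _ = (n p ≫ Y.σ.map ((𝟙 p.1, ht.from p.2) : p ⟶ (p.1, t))) ≫
              Y.σ.map ((r.1, 𝟙 t) : (p.1, t) ⟶ (q.1, t)) := by
            rw [hr, X.σ.map_comp, Category.assoc, hm_nat, hnc, Category.assoc]
        _ = (n p ≫ Y.σ.map r) ≫ Y.σ.map ((𝟙 q.1, ht.from q.2) : q ⟶ (q.1, t)) := by
            rw [Category.assoc, Category.assoc, ← Y.σ.map_comp, ← Y.σ.map_comp, hr]
  · have hti : ((hi.to i, 𝟙 t) : (i, t) ⟶ (i, t)) = 𝟙 (i, t) :=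
      Prod.ext (hi.hom_ext _ _) rfl
    have htt : ((𝟙 i, ht.from t) : (i, t) ⟶ (i, t)) = 𝟙 (i, t) :=
      Prod.ext rfl (ht.hom_ext _ _)
    have hm_i := hmc i
    have hn_it := hnc (i, t)
    dsimp only at hn_it
    rw [hti, X.σ.map_id, Y.σ.map_id, Category.id_comp] at hm_i
    rw [htt, X.σ.map_id, Y.σ.map_id, Category.id_comp, Category.comp_id, hm_i] at hn_it
    exact (hn_it.trans (Category.comp_id _)).trans hf₀

theorem twoSectEval_essSurj {i : A} {t : B} (hi : IsInitial i) (ht : IsTerminal t)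
    (h2s : IsTwoSidedFib ξ π) : (twoSectEval ξ π i t).EssSurj := by
  obtain ⟨hl, hr, hcomm⟩ := h2s
  refine ⟨fun e => ?_⟩
  have hei := isInitialOfEq hi e.ha
  choose P k hP hk hkπ _ using fun x : A => hl e.e (hei.to x)
  have hPt (x : A) : π.obj (P x) = t := (hkπ x).choose.symm.trans e.hb
  have hPterm (x : A) : IsTerminal (π.obj (P x)) := isTerminalOfEq ht (hPt x)
  choose S c hS hc hcξ _ using fun p : A × B => hr (P p.1) ((hPterm p.1).from p.2)
  have hSξ (p : A × B) : ξ.obj (S p) = p.1 := (hcξ p).choose.trans (hP p.1)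
  have hcξ' (p : A × B) : ξ.map (c p) = eqToHom ((hSξ p).trans (hP p.1).symm) :=
    (hcξ p).choose_spec
  have hPmap {x x' : A} (u : x ⟶ x') : ∃ m : P x ⟶ P x',
      ξ.map m = eqToHom (hP x) ≫ u ≫ eqToHom (hP x').symm ∧ k x ≫ m = k x' :=
    (hk x _ _ (hei.hom_ext _ _)).exists
  choose Pm hPmξ hPmk using @hPmap
  have hSmap {p q : A × B} (r : p ⟶ q) : ∃ m : S p ⟶ S q,
      π.map m = eqToHom (hS p) ≫ r.2 ≫ eqToHom (hS q).symm ∧ m ≫ c q = c p ≫ Pm r.1 :=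
    (hc q _ _ ((hPterm q.1).hom_ext _ _)).exists
  choose Sm hSmπ hSmc using @hSmap
  have hSmξ {p q : A × B} (r : p ⟶ q) :
      ξ.map (Sm r) = eqToHom (hSξ p) ≫ r.1 ≫ eqToHom (hSξ q).symm := by
    have h := congrArg ξ.map (hSmc r)
    simp only [Functor.map_comp, hcξ', hPmξ] at h
    simpa using h =≫ eqToHom ((hP q.1).trans (hSξ q).symm)
  have hPm_id (x : A) : Pm (𝟙 x) = 𝟙 (P x) :=
    (hk x).hom_ext (by simp [hPmξ]) (by simp [hPmk])
  have hPm_comp {x y z : A} (u : x ⟶ y) (v : y ⟶ z) : Pm (u ≫ v) = Pm u ≫ Pm v :=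
    (hk x).hom_ext (by simp [hPmξ]) (by rw [hPmk, ← Category.assoc, hPmk, hPmk])
  let σ : A × B ⥤ E :=
    { obj := S
      map := Sm
      map_id := fun p => (hc p).hom_ext (by simp [hSmπ]) (by simp [hSmc, hPm_id])
      map_comp := fun {p q s} f g => (hc s).hom_ext (by simp [hSmπ]) (by
        rw [hSmc, Category.assoc, hSmc, ← Category.assoc, hSmc, Category.assoc, ← hPm_comp]
        rfl) }
  have hsect : σ ⋙ ξ.prod' π = 𝟭 (A × B) := by
    refine CategoryTheory.Functor.ext (fun p => Prod.ext (hSξ p) (hS p)) fun p q r => ?_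
    refine Prod.ext ?_ ?_
    · simpa using hSmξ r
    · simpa using hSmπ r
  have hopcart ⦃x x' : A⦄ (u : x ⟶ x') (y : B) :
      IsOpcartesianMor ξ (Sm ((u, 𝟙 y) : (x, y) ⟶ (x', y))) := by
    have hPu : IsOpcartesianMor ξ (Pm u) := (hk x).of_comp (by rw [hPmk]; exact hk x')
    have hPv : IsVerticalMor π (Pm u) :=
      ⟨(hPt x).trans (hPt x').symm, (hPterm x').hom_ext _ _⟩
    obtain ⟨z, f, hz, hf, hfπ, hfu⟩ := hl (S (x, y)) (eqToHom (hSξ (x, y)) ≫ u)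
    have hfξ : ξ.map f = eqToHom (hSξ (x, y)) ≫ u ≫ eqToHom hz.symm := by
      simpa using hfu =≫ eqToHom hz.symm
    obtain ⟨g, ⟨hgξ, hfg⟩, -⟩ := hf (c (x, y) ≫ Pm u) (eqToHom (hz.trans (hP x').symm))
      (by simp [hfξ, hcξ', hPmξ])
    have hzπ : π.obj z = y := hfπ.choose.symm.trans (hS (x, y))
    obtain ⟨h, ⟨hhπ, hhc⟩, -⟩ := hc (x', y) g (eqToHom (hzπ.trans (hS (x', y)).symm))
      ((hPterm x').hom_ext _ _)
    have hhξ : ξ.map h = eqToHom (hz.trans (hSξ (x', y)).symm) := by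
      have h' := congrArg ξ.map hhc
      simp only [Functor.map_comp, hcξ', hgξ] at h'
      simpa using h' =≫ eqToHom ((hP x').trans (hSξ (x', y)).symm)
    have : IsIso h :=
      hcomm (Pm u) (c (x, y)) f (c (x', y)) g h hPu hPv (hc _) (hcξ _) hf hfπ
        ⟨(hSξ (x, y)).trans (hP x).symm, hz.trans (hP x').symm, by simp [hfξ, hPmξ]⟩
        (hc _) (hcξ _)
        ⟨(hS (x', y)).trans (hS (x, y)).symm, (hPt x').trans (hPt x).symm,
          (hPterm x).hom_ext _ _⟩
        ⟨_, hgξ⟩ hfg ⟨_, hhξ⟩ ⟨_, hhπ⟩ hhc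
    have hfh : Sm ((u, 𝟙 y) : (x, y) ⟶ (x', y)) = f ≫ h := by
      refine (hc (x', y)).hom_ext ?_ ?_
      · simp [hSmπ, hhπ, hfπ.choose_spec]
      · rw [hSmc, Category.assoc, hhc, hfg]
    rw [hfh]
    exact hf.comp_isIso h
  have hcart (x : A) ⦃y y' : B⦄ (v : y ⟶ y') :
      IsCartesianMor π (Sm ((𝟙 x, v) : (x, y) ⟶ (x, y'))) :=
    (hc (x, y')).of_comp (by rw [hSmc, hPm_id, Category.comp_id]; exact hc (x, y))
  have hkξ : ξ.map (k i) = eqToHom (e.ha.trans (hP i).symm) := hei.hom_ext _ _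
  have hcπ : π.map (c (i, t)) = eqToHom ((hS (i, t)).trans (hPt i).symm) :=
    (hPterm i).hom_ext _ _
  have : IsIso (ξ.map (k i)) := by rw [hkξ]; infer_instance
  have : IsIso (π.map (c (i, t))) := by rw [hcπ]; infer_instance
  have : IsIso (k i) := (hk i).isIso
  have : IsIso (c (i, t)) := (hc (i, t)).isIso
  let X : TwoSect ξ π := ⟨σ, hsect, hopcart, hcart⟩
  have hfξ : ξ.map (c (i, t) ≫ inv (k i)) = eqToHom ((hSξ (i, t)).trans e.ha.symm) := by
    rw [Functor.map_comp, Functor.map_inv, IsIso.comp_inv_eq, hcξ', hkξ, eqToHom_trans]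
  have hfπ : π.map (c (i, t) ≫ inv (k i)) = eqToHom ((hS (i, t)).trans e.hb.symm) := by
    rw [Functor.map_comp, Functor.map_inv, IsIso.comp_inv_eq, hcπ, (hkπ i).choose_spec,
      eqToHom_trans]
  let f : (twoSectEval ξ π i t).obj X ⟶ e := ⟨c (i, t) ≫ inv (k i), hfξ, hfπ⟩
  have : IsIso f.f := inferInstanceAs (IsIso (c (i, t) ≫ inv (k i)))
  exact ⟨X, BiFiberCat.nonempty_iso f⟩

/-- Evaluation at an initial object on the left and a terminal object on the right is an
equivalence from two-sided cartesian sections to the bifiber. -/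
theorem twoSectEval_isEquivalence_s18 {i : A} {t : B} (hi : IsInitial i) (ht : IsTerminal t)
    (h2s : IsTwoSidedFib ξ π) : (twoSectEval ξ π i t).IsEquivalence where
  faithful := twoSectEval_faithful hi ht
  full := twoSectEval_full hi ht
  essSurj := twoSectEval_essSurj hi ht h2s

end TwoSidedSections

section Statement19

variable {A : Type u₁} [Category.{v₁} A] {B : Type u₂} [Category.{v₂} B]
  {Q : Type u₃} [Category.{v₃} Q]

/-- **Dependent Yoneda Lemma for two-sided fibrations.** For objects `a : A`,
`b : B` and any two-sided fibration `⟨ξ,π⟩ : Q ⥤ (a\A) × (B/b)`, evaluation at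
`(id_a, id_b)` is an equivalence from the category of two-sided cartesian sections
to the bifiber over `(id_a, id_b)`. -/
theorem dependent_yoneda_twoSided (a : A) (b : B)
    (ξ : Q ⥤ Under a) (π : Q ⥤ Over b) (h2s : IsTwoSidedFib ξ π) :
    (twoSectEval ξ π (Under.mk (𝟙 a)) (Over.mk (𝟙 b))).IsEquivalence := by
  exact twoSectEval_isEquivalence_s18 Under.mkIdInitial Over.mkIdTerminal h2s

end Statement19
end
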